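/- arXiv:1612.09427 — 2 statements merged into one kernel-verified Lean document; each statement's English description precedes it below -/
import Mathlib

section
/- Let d ≥ 3 and let F ≤ Sym({1,…,d}) be primitive but not cyclic of prime order. Then U(F)⁺ has the Howe–Moore property if and only if for every unitary representation (π, ℋ) of U(F)⁺ without nonzero U(F)⁺-invariant vectors and for every nonzero vector v ∈ ℋ, the isotropy subgroup (U(F)⁺)_v = {g ∈ U(F)⁺ : π(g)v = v} is a compact subgroup of U(F)⁺. -/
open Filter Topology
open scoped InnerProductSpace

namespace TreeHM

variable {V : Type}

/-! ### The automorphism group of a graph, with the topology of pointwise convergence -/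

noncomputable instance autTopologicalSpace (T : SimpleGraph V) : TopologicalSpace (T ≃g T) :=
  letI : TopologicalSpace V := ⊥
  TopologicalSpace.induced (fun (g : T ≃g T) (x : V) => g x) inferInstance

/-- A graph automorphism preserves the combinatorial distance. -/
theorem iso_dist_le (T : SimpleGraph V) (g : T ≃g T) (u v : V) :
    T.dist (g u) (g v) ≤ T.dist u v := by
  by_cases h : T.Reachable u v
  · obtain ⟨p, hp⟩ := h.exists_walk_length_eq_dist
    calc T.dist (g u) (g v) ≤ (p.map g.toHom).length := SimpleGraph.dist_le _
      _ = p.length := SimpleGraph.Walk.length_map _ _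
      _ = T.dist u v := hp
  · rw [SimpleGraph.dist_eq_zero_of_not_reachable h,
      SimpleGraph.dist_eq_zero_of_not_reachable]
    intro hr
    have := hr.map g.symm.toHom
    exact h (by simpa using this)

theorem iso_dist_eq (T : SimpleGraph V) (g : T ≃g T) (u v : V) :
    T.dist (g u) (g v) = T.dist u v := by
  refine le_antisymm (iso_dist_le T g u v) ?_
  have := iso_dist_le T g⁻¹ (g u) (g v)
  simpa using this

/-- The tree `T` is locally finite. -/
def LocFin (T : SimpleGraph V) : Prop := ∀ x : V, (T.neighborSet x).Finite

/-- The graph `T` is `d`-regular: every vertex has exactly `d` neighbours. -/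
def Regular (T : SimpleGraph V) (d : ℕ) : Prop := ∀ x : V, (T.neighborSet x).ncard = d

/-! ### Geodesic rays and ends -/

/-- A geodesic ray in a graph; for a tree, the ends `∂T` are the equivalence classes of
geodesic rays under the relation `RayEquiv` of sharing a common subray.  Throughout, an end
`ξ ∈ ∂T` is represented by a geodesic ray, and equality of ends is `RayEquiv`. -/
structure GeodRay (T : SimpleGraph V) : Type where
  seq : ℕ → V
  adj : ∀ n, T.Adj (seq n) (seq (n + 1))
  geodesic : ∀ m n, T.dist (seq m) (seq n) = Nat.dist m n

/-- A bi-infinite geodesic line in a graph. -/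
structure GeodLine (T : SimpleGraph V) : Type where
  seq : ℤ → V
  adj : ∀ n, T.Adj (seq n) (seq (n + 1))
  geodesic : ∀ m n, T.dist (seq m) (seq n) = (m - n).natAbs

/-- Two geodesic rays are equivalent (define the same end) iff they share a common subray. -/
def RayEquiv (T : SimpleGraph V) (r s : GeodRay T) : Prop :=
  ∃ k l : ℕ, ∀ n : ℕ, r.seq (k + n) = s.seq (l + n)

/-- The image of a geodesic ray under an automorphism. -/
def mapRay (T : SimpleGraph V) (g : T ≃g T) (r : GeodRay T) : GeodRay T where
  seq := fun n => g (r.seq n)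
  adj := fun n => g.map_adj_iff.mpr (r.adj n)
  geodesic := fun m n => by rw [iso_dist_eq]; exact r.geodesic m n

/-- `g` fixes the end represented by the ray `r`. -/
def FixesEnd (T : SimpleGraph V) (g : T ≃g T) (r : GeodRay T) : Prop :=
  RayEquiv T (mapRay T g r) r

/-- A sequence of vertices converges to the end represented by the geodesic ray `r`:
for every `m`, the vertex `r.seq m` eventually lies on the geodesic from `r.seq 0` to `y n`,
i.e. the common initial segment of `[r.seq 0, y n]` and the ray tends to infinity. -/
def TendstoEnd (T : SimpleGraph V) (y : ℕ → V) (r : GeodRay T) : Prop :=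
  ∀ m : ℕ, ∀ᶠ n in atTop, T.dist (r.seq 0) (y n) = m + T.dist (r.seq m) (y n)

/-! ### Translation length and hyperbolic automorphisms -/

/-- The translation length `|g| = min_x dist(x, g x)` of an automorphism. -/
noncomputable def transLen (T : SimpleGraph V) (g : T ≃g T) : ℕ :=
  sInf (Set.range fun x : V => T.dist x (g x))

/-- `g` is hyperbolic iff its translation length is positive. -/
def IsHyperbolic (T : SimpleGraph V) (g : T ≃g T) : Prop := 0 < transLen T g

/-- The set `Min(g)` of vertices realizing the translation length; for a hyperbolic
automorphism of a tree this is its translation axis. -/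
def MinSet (T : SimpleGraph V) (g : T ≃g T) : Set V :=
  {x : V | T.dist x (g x) = transLen T g}

/-- The ray `r` (based at the axis) represents the attracting end of `a`:
the orbit `a^n x` converges to this end. -/
def IsAttractingEnd (T : SimpleGraph V) (a : T ≃g T) (r : GeodRay T) : Prop :=
  TendstoEnd T (fun n : ℕ => (a ^ n) (r.seq 0)) r

/-! ### Half-trees and Tits' independence property -/

/-- The half-tree determined by an oriented edge `(a, b)` of a tree:  all vertices `y`
lying on the side of `a`, i.e. whose geodesic to `b` passes through `a`. -/
def EdgeSide (T : SimpleGraph V) (a b : V) : Set V :=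
  {y : V | T.dist b y = T.dist a y + 1}

/-- The half-tree emanating from the base vertex `r.seq 0` of a ray `r` and containing the
end of `r` in its boundary. -/
def RaySide (T : SimpleGraph V) (r : GeodRay T) : Set V :=
  {y : V | y = r.seq 0 ∨ T.dist (r.seq 0) y = 1 + T.dist (r.seq 1) y}

/-- Tits' independence property for a subgroup `G ≤ Aut(T)`:  for every edge `e = (a, b)`,
the pointwise stabilizer `G_e` decomposes as `G_{T₁} · G_{T₂}`, where `T₁, T₂` are the two
half-trees emanating from `e` and `G_{Tᵢ}` is the pointwise stabilizer of `Tᵢ`. -/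
def TitsIndep (T : SimpleGraph V) (G : Subgroup (T ≃g T)) : Prop :=
  ∀ a b : V, T.Adj a b → ∀ g ∈ G, g a = a → g b = b →
    ∃ g₁ ∈ G, ∃ g₂ ∈ G, g = g₁ * g₂ ∧
      (∀ y ∈ EdgeSide T a b, g₁ y = y) ∧ (∀ y ∈ EdgeSide T b a, g₂ y = y)

/-! ### Stabilizers and contraction groups -/

/-- The subgroup `G_ξ⁰ = {g ∈ G : g ξ = ξ and g fixes some vertex}`, as a subset of `G`. -/
def EndStab0 (T : SimpleGraph V) (G : Subgroup (T ≃g T)) (ξ : GeodRay T) : Set G :=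
  {g : G | FixesEnd T (g : T ≃g T) ξ ∧ ∃ x : V, (g : T ≃g T) x = x}

/-- The contraction group `U⁺_α` of a sequence `α` in `G`. -/
def ContrSeq {G : Type} [Group G] [TopologicalSpace G] (α : ℕ → G) : Set G :=
  {g : G | Tendsto (fun n : ℕ => (α n)⁻¹ * g * α n) atTop (𝓝 1)}

/-- The contraction group `U⁺_a = {g : a⁻ⁿ g aⁿ → 1}` of an element `a` of `G`. -/
def Upos {G : Type} [Group G] [TopologicalSpace G] (a : G) : Set G :=
  ContrSeq (fun n : ℕ => a ^ n)

/-- The contraction group `U⁻_a = {g : aⁿ g a⁻ⁿ → 1}` of an element `a` of `G`. -/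
def Uneg {G : Type} [Group G] [TopologicalSpace G] (a : G) : Set G :=
  ContrSeq (fun n : ℕ => (a ^ n)⁻¹)

/-! ### Unitary representations and the Howe–Moore property -/

/-- A (strongly continuous) unitary representation of a topological group `G` on a complex
inner product space `H`. -/
structure UnitaryRep (G : Type) [Group G] [TopologicalSpace G]
    (H : Type) [NormedAddCommGroup H] [InnerProductSpace ℂ H] where
  ρ : G →* (H ≃ₗᵢ[ℂ] H)
  strong_continuity : ∀ v : H, Continuous fun g : G => ρ g v

/-- The representation `π` has no nonzero `G`-invariant vector. -/
def NoInvariantVectors {G : Type} [Group G] [TopologicalSpace G]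
    {H : Type} [NormedAddCommGroup H] [InnerProductSpace ℂ H]
    (π : UnitaryRep G H) : Prop :=
  ∀ v : H, (∀ g : G, π.ρ g v = v) → v = 0

/-- The Howe–Moore property: every unitary representation without nonzero invariant vectors
has all its matrix coefficients vanishing at infinity. -/
def HasHoweMoore (G : Type) [Group G] [TopologicalSpace G] : Prop :=
  ∀ (H : Type) [NormedAddCommGroup H] [InnerProductSpace ℂ H] [CompleteSpace H]
    (π : UnitaryRep G H), NoInvariantVectors π →
      ∀ v w : H, Tendsto (fun g : G => ⟪π.ρ g v, w⟫_ℂ) (cocompact G) (𝓝 0)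

/-! ### Legal colorings and the universal groups of Burger–Mozes -/

/-- A legal coloring of a `d`-regular tree: a coloring of the (unoriented) edges by
`{1, …, d}` whose restriction to the star of each vertex is a bijection onto `{1, …, d}`.
The color of the edge `{x, y}` is recorded as `color x y` with `color x y = color y x`. -/
structure LegalColoring (T : SimpleGraph V) (d : ℕ) where
  color : V → V → Fin d
  symm : ∀ x y : V, T.Adj x y → color x y = color y x
  injOn : ∀ x : V, Set.InjOn (color x) (T.neighborSet x)
  surjOn : ∀ x : V, Set.SurjOn (color x) (T.neighborSet x) Set.univ

/-- Membership in the universal group `U(F)`: at every vertex `x` the local action of `g`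
on colors is given by an element of `F`. -/
def InUF {d : ℕ} (T : SimpleGraph V) (F : Subgroup (Equiv.Perm (Fin d)))
    (ι : LegalColoring T d) (g : T ≃g T) : Prop :=
  ∀ x : V, ∃ σ ∈ F, ∀ y : V, T.Adj x y → σ (ι.color x y) = ι.color (g x) (g y)

/-- The universal group `U(F)⁺`: the subgroup of `Aut(T)` generated by the elements of
`U(F)` fixing (pointwise) an edge of `T`. -/
def UFplus {d : ℕ} (T : SimpleGraph V) (F : Subgroup (Equiv.Perm (Fin d)))
    (ι : LegalColoring T d) : Subgroup (T ≃g T) :=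
  Subgroup.closure
    {g : T ≃g T | InUF T F ι g ∧ ∃ x y : V, T.Adj x y ∧ g x = x ∧ g y = y}

/-! ### Permutation group conditions -/

/-- `F` acts transitively on `{1, …, d}`. -/
def PermTransitive {d : ℕ} (F : Subgroup (Equiv.Perm (Fin d))) : Prop :=
  ∀ i j : Fin d, ∃ σ ∈ F, σ i = j

/-- `F` acts 2-transitively on `{1, …, d}`. -/
def PermTwoTransitive {d : ℕ} (F : Subgroup (Equiv.Perm (Fin d))) : Prop :=
  ∀ a b c e : Fin d, a ≠ b → c ≠ e → ∃ σ ∈ F, σ a = c ∧ σ b = e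

/-- `F` acts primitively on `{1, …, d}`: it is transitive and every block of the action
is trivial (a subsingleton or the whole set). -/
def PermPrimitive {d : ℕ} (F : Subgroup (Equiv.Perm (Fin d))) : Prop :=
  PermTransitive F ∧
    ∀ B : Set (Fin d),
      (∀ σ ∈ F, (σ : Equiv.Perm (Fin d)) '' B = B ∨
        Disjoint ((σ : Equiv.Perm (Fin d)) '' B) B) →
      B.Subsingleton ∨ B = Set.univ

/-- `F` is a cyclic group of prime order. -/
def CyclicOfPrimeOrder {d : ℕ} (F : Subgroup (Equiv.Perm (Fin d))) : Prop :=
  IsCyclic F ∧ (Nat.card F).Prime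

/-- `F` is generated by its point stabilizers `F_i = {σ ∈ F : σ i = i}`. -/
def GenByPointStabilizers {d : ℕ} (F : Subgroup (Equiv.Perm (Fin d))) : Prop :=
  F = Subgroup.closure {σ : Equiv.Perm (Fin d) | σ ∈ F ∧ ∃ i : Fin d, σ i = i}



/-! ### Proof: tree geometry -/

theorem exists_closer (T : SimpleGraph V) (hT : T.IsTree) (a x : V) (hx : x ≠ a) :
    ∃ y, T.Adj x y ∧ T.dist a x = T.dist a y + 1 := by
  obtain ⟨p, hp⟩ := hT.connected.exists_walk_length_eq_dist x a
  cases p with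
  | nil => exact absurd rfl hx
  | @cons _ y _ h q =>
    refine ⟨y, h, ?_⟩
    have h1 : T.dist y a ≤ q.length := SimpleGraph.dist_le q
    have h2 := hT.dist_eq_dist_add_one_of_adj a h
    simp only [SimpleGraph.Walk.length_cons] at hp
    rw [SimpleGraph.dist_comm] at h1 hp
    omega

theorem closer_unique (T : SimpleGraph V) (hT : T.IsTree) (a x y z : V)
    (hy : T.Adj x y) (hz : T.Adj x z) (h1 : T.dist a x = T.dist a y + 1)
    (h2 : T.dist a x = T.dist a z + 1) : y = z := by
  obtain ⟨p, hp⟩ := hT.connected.exists_walk_length_eq_dist a y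
  obtain ⟨q, hq⟩ := hT.connected.exists_walk_length_eq_dist a z
  have hp' : (p.concat hy.symm).IsPath := SimpleGraph.Walk.isPath_of_length_eq_dist _ (by
    rw [SimpleGraph.Walk.length_concat]; omega)
  have hq' : (q.concat hz.symm).IsPath := SimpleGraph.Walk.isPath_of_length_eq_dist _ (by
    rw [SimpleGraph.Walk.length_concat]; omega)
  have := (hT.existsUnique_path a x).unique hp' hq'
  have h3 := congrArg SimpleGraph.Walk.penultimate this
  simpa using h3

theorem side_or (T : SimpleGraph V) (hT : T.IsTree) {a b : V} (hab : T.Adj a b) (y : V) :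
    y ∈ EdgeSide T a b ∨ y ∈ EdgeSide T b a := by
  have h := hT.dist_eq_dist_add_one_of_adj y hab
  simp only [EdgeSide, Set.mem_ofPred_eq]
  rw [SimpleGraph.dist_comm (u := b), SimpleGraph.dist_comm (u := a)]
  omega

theorem side_not (T : SimpleGraph V) {a b : V} {y : V}
    (h1 : y ∈ EdgeSide T a b) (h2 : y ∈ EdgeSide T b a) : False := by
  simp only [EdgeSide, Set.mem_ofPred_eq] at h1 h2
  omega

theorem side_self (T : SimpleGraph V) {a b : V} (hab : T.Adj a b) : a ∈ EdgeSide T a b := by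
  have := SimpleGraph.dist_eq_one_iff_adj.mpr hab.symm
  simp [EdgeSide, this]

theorem crossing (T : SimpleGraph V) (hT : T.IsTree) {a b : V} (hab : T.Adj a b) {x z : V}
    (hx : x ∈ EdgeSide T a b) (hz : z ∈ EdgeSide T b a) (hxz : T.Adj x z) : x = a ∧ z = b := by
  simp only [EdgeSide, Set.mem_ofPred_eq] at hx hz
  have h1 := hT.dist_eq_dist_add_one_of_adj a hxz
  have h2 := hT.dist_eq_dist_add_one_of_adj b hxz
  by_cases hxa : x = a
  · subst hxa
    refine ⟨rfl, ?_⟩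
    have h3 : T.dist x x = 0 := SimpleGraph.dist_self
    have h4 : T.dist b z = 0 := by omega
    exact ((hT.connected.dist_eq_zero_iff).mp h4).symm
  · exfalso
    obtain ⟨y, hy, hy'⟩ := exists_closer T hT a x hxa
    have h3 := hT.dist_eq_dist_add_one_of_adj b hy
    have h4 : T.dist b y ≤ T.dist b a + T.dist a y := hT.connected.dist_triangle
    have h5 : T.dist b a = 1 := SimpleGraph.dist_eq_one_iff_adj.mpr hab.symm
    have := closer_unique T hT b x y z hy hxz (by omega) (by omega)
    subst this
    omega

theorem walk_cross (T : SimpleGraph V) (hT : T.IsTree) {a b : V} (hab : T.Adj a b) {x z : V}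
    (p : T.Walk x z) (hx : x ∈ EdgeSide T a b) (hz : z ∈ EdgeSide T b a) :
    T.dist x a + 1 + T.dist b z ≤ p.length := by
  induction p with
  | nil => exact (side_not T hx hz).elim
  | @cons x y z h q ih =>
    rw [SimpleGraph.Walk.length_cons]
    rcases side_or T hT hab y with hy | hy
    · have h1 := ih hy hz
      have h2 : T.dist x a ≤ T.dist x y + T.dist y a := hT.connected.dist_triangle
      have h3 : T.dist x y = 1 := SimpleGraph.dist_eq_one_iff_adj.mpr h
      omega
    · obtain ⟨rfl, rfl⟩ := crossing T hT hab hx hy h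
      have := SimpleGraph.dist_le q
      simp
      omega

theorem dist_cross (T : SimpleGraph V) (hT : T.IsTree) {a b : V} (hab : T.Adj a b) {x z : V}
    (hx : x ∈ EdgeSide T a b) (hz : z ∈ EdgeSide T b a) :
    T.dist x a + 1 + T.dist b z ≤ T.dist x z := by
  obtain ⟨p, hp⟩ := hT.connected.exists_walk_length_eq_dist x z
  rw [← hp]
  exact walk_cross T hT hab p hx hz

theorem ball_finite (T : SimpleGraph V) (hT : T.IsTree) (hf : LocFin T) (x : V) (n : ℕ) :
    {y | T.dist x y ≤ n}.Finite := by
  induction n with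
  | zero =>
    refine (Set.finite_singleton x).subset ?_
    intro y hy
    simp only [Set.mem_ofPred_eq, Nat.le_zero] at hy
    exact ((hT.connected.dist_eq_zero_iff).mp hy).symm
  | succ n ih =>
    refine (ih.union (ih.biUnion (fun y _ => hf y))).subset ?_
    intro y hy
    simp only [Set.mem_ofPred_eq] at hy
    by_cases hyx : y = x
    · left; subst hyx; simp
    · obtain ⟨z, hz, hz'⟩ := exists_closer T hT x y hyx
      right
      simp only [Set.mem_iUnion]
      exact ⟨z, by simp only [Set.mem_ofPred_eq]; omega, hz.symm⟩

/-! ### Proof: permutation groups -/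

theorem stab_moves {d : ℕ} (hd : 3 ≤ d) (F : Subgroup (Equiv.Perm (Fin d)))
    (hprim : PermPrimitive F) (hncyc : ¬ CyclicOfPrimeOrder F) (i j : Fin d) (hij : i ≠ j) :
    ∃ σ ∈ F, σ i = i ∧ σ j ≠ j := by
  by_contra hcon
  push Not at hcon
  obtain ⟨htr, hbl⟩ := hprim
  let S : Fin d → Set (Equiv.Perm (Fin d)) := fun k => {σ | σ ∈ F ∧ σ k = k}
  have hSconj : ∀ τ ∈ F, ∀ k l, S k = S l → S (τ k) = S (τ l) := by
    intro τ hτ k l hkl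
    ext σ
    have key : ∀ m, σ ∈ S (τ m) ↔ τ⁻¹ * σ * τ ∈ S m := by
      intro m
      simp only [S, Set.mem_ofPred_eq, Equiv.Perm.mul_apply, Equiv.Perm.inv_eq_iff_eq]
      constructor
      · rintro ⟨h1, h2⟩
        exact ⟨F.mul_mem (F.mul_mem (F.inv_mem hτ) h1) hτ, h2⟩
      · rintro ⟨h1, h2⟩
        refine ⟨?_, h2⟩
        have := F.mul_mem (F.mul_mem hτ h1) (F.inv_mem hτ)
        simpa [mul_assoc] using this
    rw [key, key, hkl]
  have hSij : S i = S j := by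
    have hsub : S i ⊆ S j := fun σ hσ => ⟨hσ.1, hcon σ hσ.1 hσ.2⟩
    obtain ⟨τ, hτ, hτi⟩ := htr i j
    apply Set.eq_of_subset_of_ncard_le hsub _ (Set.toFinite _)
    refine Set.ncard_le_ncard_of_injOn (fun σ => τ⁻¹ * σ * τ) ?_ ?_ (Set.toFinite _)
    · rintro σ ⟨h1, h2⟩
      refine ⟨F.mul_mem (F.mul_mem (F.inv_mem hτ) h1) hτ, ?_⟩
      simp only [Equiv.Perm.mul_apply, Equiv.Perm.inv_eq_iff_eq]
      rw [hτi, h2]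
    · intro σ _ σ' _ h
      simpa using h
  have hB := hbl {k | S k = S i} (by
    intro σ hσ
    by_cases hd : Disjoint ((σ : Equiv.Perm (Fin d)) '' {k | S k = S i}) {k | S k = S i}
    · exact Or.inr hd
    · left
      rw [Set.not_disjoint_iff] at hd
      obtain ⟨_, ⟨k, hk, rfl⟩, hk'⟩ := hd
      simp only [Set.mem_ofPred_eq] at hk hk'
      ext l
      simp only [Set.mem_image, Set.mem_ofPred_eq]
      constructor
      · rintro ⟨m, hm, rfl⟩
        rw [← hk']
        exact hSconj σ hσ _ _ (hm.trans hk.symm)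
      · intro hl
        refine ⟨σ⁻¹ l, ?_, by simp⟩
        have := hSconj σ⁻¹ (F.inv_mem hσ) l (σ k) (hl.trans hk'.symm)
        rw [this]
        simpa using hk)
  rcases hB with hB | hB
  · exact hij (hB (by simp) (by simp [hSij]))
  -- now the action is regular
  have hreg : ∀ σ ∈ F, ∀ k, σ k = k → σ = 1 := by
    intro σ hσ k hk
    ext l
    have h1 : S k = S i := by
      have : k ∈ {k | S k = S i} := hB ▸ Set.mem_univ k
      exact this
    have h2 : S l = S i := by
      have : l ∈ {k | S k = S i} := hB ▸ Set.mem_univ l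
      exact this
    have h3 : σ ∈ S l := by rw [h2, ← h1]; exact ⟨hσ, hk⟩
    have h4 := h3.2
    simp [h4]
  have hsubg : ∀ H : Subgroup (Equiv.Perm (Fin d)), H ≤ F → H ≠ ⊥ → F ≤ H := by
    intro H hHF hne
    have := hbl {k | ∃ h ∈ H, h i = k} (by
      intro σ hσ
      by_cases hd : Disjoint ((σ : Equiv.Perm (Fin d)) '' {k | ∃ h ∈ H, h i = k})
          {k | ∃ h ∈ H, h i = k}
      · exact Or.inr hd
      · left
        rw [Set.not_disjoint_iff] at hd
        obtain ⟨_, ⟨_, ⟨h, hh, rfl⟩, rfl⟩, ⟨h', hh', hk'⟩⟩ := hd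
        have h1 : h'⁻¹ * σ * h = 1 := by
          apply hreg _ (F.mul_mem (F.mul_mem (F.inv_mem (hHF hh')) hσ) (hHF hh)) i
          simp only [Equiv.Perm.mul_apply, Equiv.Perm.inv_eq_iff_eq]
          exact hk'.symm
        have h2 : σ = h' * h⁻¹ := by
          rw [mul_assoc, inv_mul_eq_one] at h1
          rw [h1]; simp
        have hσH : σ ∈ H := h2 ▸ H.mul_mem hh' (H.inv_mem hh)
        ext l
        simp only [Set.mem_image, Set.mem_ofPred_eq]
        constructor
        · rintro ⟨_, ⟨m, hm, rfl⟩, rfl⟩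
          exact ⟨σ * m, H.mul_mem hσH hm, rfl⟩
        · rintro ⟨m, hm, rfl⟩
          exact ⟨σ⁻¹ (m i), ⟨σ⁻¹ * m, H.mul_mem (H.inv_mem hσH) hm, rfl⟩, by simp⟩)
    rcases this with h | h
    · exfalso
      apply hne
      rw [Subgroup.eq_bot_iff_forall]
      intro x hx
      exact hreg x (hHF hx) i (h ⟨x, hx, rfl⟩ ⟨1, H.one_mem, rfl⟩)
    · intro σ hσ
      have h1 : σ i ∈ {k | ∃ h ∈ H, h i = k} := h ▸ Set.mem_univ _
      obtain ⟨m, hm, hmi⟩ := h1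
      have : m⁻¹ * σ = 1 := hreg _ (F.mul_mem (F.inv_mem (hHF hm)) hσ) i (by
        simp only [Equiv.Perm.mul_apply, Equiv.Perm.inv_eq_iff_eq]
        exact hmi.symm)
      rw [inv_mul_eq_one] at this
      exact this ▸ hm
  apply hncyc
  obtain ⟨τ, hτ, hτi⟩ := htr i j
  have hcard : Nat.card F ≠ 1 := by
    intro h
    rw [Subgroup.card_eq_one] at h
    rw [h, Subgroup.mem_bot] at hτ
    subst hτ
    exact hij hτi
  obtain ⟨p, hp, hpd⟩ := Nat.exists_prime_and_dvd hcard
  have := Fact.mk hp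
  obtain ⟨g, hg⟩ := exists_prime_orderOf_dvd_card' (G := F) p hpd
  have hgz : Subgroup.zpowers (g : Equiv.Perm (Fin d)) = F := by
    apply le_antisymm
    · rw [Subgroup.zpowers_le]; exact g.2
    · apply hsubg
      · rw [Subgroup.zpowers_le]; exact g.2
      · intro h
        rw [Subgroup.zpowers_eq_bot] at h
        have : g = 1 := by ext1; exact h
        rw [this, orderOf_one] at hg
        exact hp.one_lt.ne hg
  constructor
  · rw [← hgz]; infer_instance
  · have : Nat.card F = p := by
      rw [← hgz, Nat.card_zpowers, Subgroup.orderOf_coe, hg]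
    rw [this]; exact hp

/-! ### Proof: construction of elements of the universal group -/

theorem exists_colorMap {d : ℕ} (T : SimpleGraph V) (hT : T.IsTree) (ι : LegalColoring T d)
    (σ : Equiv.Perm (Fin d)) (a : V) :
    ∃ φ : V → V, φ a = a ∧ ∀ x y, T.Adj x y →
      T.Adj (φ x) (φ y) ∧ ι.color (φ x) (φ y) = σ (ι.color x y) := by
  have hs : ∀ (x : V) (c : Fin d), ∃ y, T.Adj x y ∧ ι.color x y = c := by
    intro x c
    obtain ⟨y, hy, hc⟩ := ι.surjOn x (Set.mem_univ c)
    exact ⟨y, hy, hc⟩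
  choose s hs1 hs2 using hs
  have hp : ∀ y : V, ∃ p : V, y ≠ a → T.Adj y p ∧ T.dist a y = T.dist a p + 1 := by
    intro y
    by_cases h : y = a
    · exact ⟨a, fun h' => absurd h h'⟩
    · obtain ⟨p, hp⟩ := exists_closer T hT a y h
      exact ⟨p, fun _ => hp⟩
  choose par hpar using hp
  let Φ : ℕ → V → V := fun n => Nat.rec (fun _ => a)
    (fun _ f y => s (f (par y)) (σ (ι.color (par y) y))) n
  have hΦ : ∀ y, y ≠ a → Φ (T.dist a y) y =
      s (Φ (T.dist a (par y)) (par y)) (σ (ι.color (par y) y)) := by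
    intro y hy
    rw [(hpar y hy).2]
  have key : ∀ x y, T.Adj x y → T.dist a y = T.dist a x + 1 →
      T.Adj (Φ (T.dist a x) x) (Φ (T.dist a y) y) ∧
      ι.color (Φ (T.dist a x) x) (Φ (T.dist a y) y) = σ (ι.color x y) := by
    intro x y hxy hd
    have hy : y ≠ a := by
      rintro rfl
      simp at hd
    have hx : x = par y :=
      closer_unique T hT a y x (par y) hxy.symm (hpar y hy).1 hd (hpar y hy).2
    rw [hΦ y hy, ← hx]
    exact ⟨hs1 _ _, hs2 _ _⟩
  refine ⟨fun y => Φ (T.dist a y) y, ?_, ?_⟩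
  · simp [Φ]
  · intro x y hxy
    rcases hT.dist_eq_dist_add_one_of_adj a hxy with h | h
    · obtain ⟨h1, h2⟩ := key y x hxy.symm h
      exact ⟨h1.symm, by rw [ι.symm _ _ h1.symm, h2, ι.symm _ _ hxy]⟩
    · exact key x y hxy h

theorem colorMap_id {d : ℕ} (T : SimpleGraph V) (hT : T.IsTree) (ι : LegalColoring T d)
    (a : V) (φ : V → V) (ha : φ a = a)
    (h : ∀ x y, T.Adj x y → T.Adj (φ x) (φ y) ∧ ι.color (φ x) (φ y) = ι.color x y) :
    ∀ x, φ x = x := by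
  have : ∀ n : ℕ, ∀ x, T.dist a x = n → φ x = x := by
    intro n
    induction n with
    | zero =>
      intro x hx
      have := (hT.connected.dist_eq_zero_iff).mp hx
      subst this; exact ha
    | succ n ih =>
      intro x hx
      have hxa : x ≠ a := by
        rintro rfl
        simp at hx
      obtain ⟨p, hp, hp'⟩ := exists_closer T hT a x hxa
      have hφp := ih p (by omega)
      obtain ⟨h1, h2⟩ := h p x hp.symm
      rw [hφp] at h1 h2
      exact ι.injOn p h1 hp.symm h2
  exact fun x => this _ x rfl

theorem exists_colorIso {d : ℕ} (T : SimpleGraph V) (hT : T.IsTree) (ι : LegalColoring T d)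
    (σ : Equiv.Perm (Fin d)) (a : V) :
    ∃ φ : T ≃g T, φ a = a ∧ ∀ x y, T.Adj x y → ι.color (φ x) (φ y) = σ (ι.color x y) := by
  obtain ⟨φ, ha, hφ⟩ := exists_colorMap T hT ι σ a
  obtain ⟨ψ, hb, hψ⟩ := exists_colorMap T hT ι σ⁻¹ a
  have h1 : ∀ x, ψ (φ x) = x := by
    refine colorMap_id T hT ι a (fun x => ψ (φ x)) (by simp [ha, hb]) ?_
    intro x y hxy
    obtain ⟨h1, h2⟩ := hφ x y hxy
    obtain ⟨h3, h4⟩ := hψ _ _ h1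
    exact ⟨h3, by rw [h4, h2]; simp⟩
  have h2 : ∀ x, φ (ψ x) = x := by
    refine colorMap_id T hT ι a (fun x => φ (ψ x)) (by simp [ha, hb]) ?_
    intro x y hxy
    obtain ⟨h1, h2⟩ := hψ x y hxy
    obtain ⟨h3, h4⟩ := hφ _ _ h1
    exact ⟨h3, by rw [h4, h2]; simp⟩
  refine ⟨⟨⟨φ, ψ, h1, h2⟩, ?_⟩, ha, fun x y hxy => (hφ x y hxy).2⟩
  intro x y
  constructor
  · intro h
    have := (hψ _ _ h).1
    simpa [h1] using this
  · intro h
    exact (hφ x y h).1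

theorem exists_halfIso {d : ℕ} (T : SimpleGraph V) (hT : T.IsTree) (ι : LegalColoring T d)
    (F : Subgroup (Equiv.Perm (Fin d))) (σ : Equiv.Perm (Fin d)) (hσ : σ ∈ F) (a b : V)
    (hab : T.Adj a b) (hfix : σ (ι.color a b) = ι.color a b) :
    ∃ h : T ≃g T, InUF T F ι h ∧ h a = a ∧ (∀ y ∈ EdgeSide T b a, h y = y) ∧
      ∀ y, T.Adj a y → ι.color a (h y) = σ (ι.color a y) := by
  classical
  obtain ⟨φ, ha, hφ⟩ := exists_colorIso T hT ι σ a
  have hb : φ b = b := by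
    have h1 : T.Adj a (φ b) := by
      have := φ.map_adj_iff.mpr hab
      rwa [ha] at this
    have h2 := hφ a b hab
    rw [ha, hfix] at h2
    exact ι.injOn a h1 hab h2
  have hA : ∀ y, φ y ∈ EdgeSide T a b ↔ y ∈ EdgeSide T a b := by
    intro y
    simp only [EdgeSide, Set.mem_ofPred_eq]
    have h1 := iso_dist_eq T φ a y
    have h2 := iso_dist_eq T φ b y
    rw [ha] at h1
    rw [hb] at h2
    rw [h1, h2]
  have hA' : ∀ y, φ.symm y ∈ EdgeSide T a b ↔ y ∈ EdgeSide T a b := by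
    intro y
    rw [← hA (φ.symm y)]
    simp
  let f : V → V := fun y => if y ∈ EdgeSide T a b then φ y else y
  let f' : V → V := fun y => if y ∈ EdgeSide T a b then φ.symm y else y
  have hff' : ∀ y, f' (f y) = y := by
    intro y
    by_cases h : y ∈ EdgeSide T a b
    · simp [f, f', h, hA]
    · simp [f, f', h]
  have hf'f : ∀ y, f (f' y) = y := by
    intro y
    by_cases h : y ∈ EdgeSide T a b
    · simp [f, f', h, hA']
    · simp [f, f', h]
  have haA : a ∈ EdgeSide T a b := side_self T hab
  have hbA : b ∉ EdgeSide T a b := fun h => side_not T h (side_self T hab.symm)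
  have hfφ : ∀ x y, x ∈ EdgeSide T a b → T.Adj x y → f y = φ y := by
    intro x y hx hxy
    by_cases hy : y ∈ EdgeSide T a b
    · simp [f, hy]
    · have hy' := (side_or T hT hab y).resolve_left hy
      obtain ⟨rfl, rfl⟩ := crossing T hT hab hx hy' hxy
      simp [f, hy, hb]
  have hfid : ∀ x y, x ∉ EdgeSide T a b → T.Adj x y → f y = y := by
    intro x y hx hxy
    by_cases hy : y ∈ EdgeSide T a b
    · have hx' := (side_or T hT hab x).resolve_left hx
      obtain ⟨rfl, rfl⟩ := crossing T hT hab hy hx' hxy.symm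
      simp [f, haA, ha]
    · simp [f, hy]
  have hf1 : ∀ x, x ∈ EdgeSide T a b → f x = φ x := fun x hx => by simp [f, hx]
  have hf2 : ∀ x, x ∉ EdgeSide T a b → f x = x := fun x hx => by simp [f, hx]
  have hfadj : ∀ x y, T.Adj x y → T.Adj (f x) (f y) := by
    intro x y hxy
    by_cases hx : x ∈ EdgeSide T a b
    · rw [hfφ x y hx hxy, hf1 x hx]
      exact φ.map_adj_iff.mpr hxy
    · rw [hfid x y hx hxy, hf2 x hx]
      exact hxy
  have hf'adj : ∀ x y, T.Adj x y → T.Adj (f' x) (f' y) := by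
    intro x y hxy
    have hsa : φ.symm a = a := by
      have := φ.symm_apply_apply a
      rwa [ha] at this
    by_cases hx : x ∈ EdgeSide T a b <;> by_cases hy : y ∈ EdgeSide T a b
    · simp only [f', hx, hy, if_true]
      exact φ.symm.map_adj_iff.mpr hxy
    · obtain ⟨rfl, rfl⟩ := crossing T hT hab hx ((side_or T hT hab y).resolve_left hy) hxy
      simp only [f', hx, hy, if_true, if_false, hsa]
      exact hxy
    · obtain ⟨rfl, rfl⟩ := crossing T hT hab hy ((side_or T hT hab x).resolve_left hx) hxy.symm
      simp only [f', hx, hy, if_true, if_false, hsa]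
      exact hxy
    · simp only [f', hx, hy, if_false]
      exact hxy
  refine ⟨⟨⟨f, f', hff', hf'f⟩, ?_⟩, ?_, ?_, ?_, ?_⟩
  · intro x y
    constructor
    · intro h
      have := hf'adj _ _ h
      simpa [hff'] using this
    · exact hfadj x y
  · intro x
    by_cases hx : x ∈ EdgeSide T a b
    · refine ⟨σ, hσ, fun y hxy => ?_⟩
      change σ (ι.color x y) = ι.color (f x) (f y)
      rw [hfφ x y hx hxy, hf1 x hx, hφ x y hxy]
    · refine ⟨1, F.one_mem, fun y hxy => ?_⟩
      change ι.color x y = ι.color (f x) (f y)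
      rw [hfid x y hx hxy, hf2 x hx]
  · change f a = a
    rw [hf1 a haA, ha]
  · intro y hy
    exact hf2 y (fun h => side_not T h hy)
  · intro y hy
    change ι.color a (f y) = _
    rw [hfφ a y haA hy, ← hφ a y hy, ha]

theorem InUF.mul {d : ℕ} {T : SimpleGraph V} {F : Subgroup (Equiv.Perm (Fin d))}
    {ι : LegalColoring T d} {g h : T ≃g T} (hg : InUF T F ι g) (hh : InUF T F ι h) :
    InUF T F ι (g * h) := by
  intro x
  obtain ⟨τ, hτ, h1⟩ := hh x
  obtain ⟨σ, hσ, h2⟩ := hg (h x)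
  refine ⟨σ * τ, F.mul_mem hσ hτ, fun y hxy => ?_⟩
  rw [Equiv.Perm.mul_apply, h1 y hxy, h2 (h y) (h.map_adj_iff.mpr hxy)]
  rfl

theorem InUF.inv {d : ℕ} {T : SimpleGraph V} {F : Subgroup (Equiv.Perm (Fin d))}
    {ι : LegalColoring T d} {g : T ≃g T} (hg : InUF T F ι g) : InUF T F ι g⁻¹ := by
  intro x
  obtain ⟨σ, hσ, h2⟩ := hg (g⁻¹ x)
  refine ⟨σ⁻¹, F.inv_mem hσ, fun y hxy => ?_⟩
  have hgg : ∀ z, g (g⁻¹ z) = z := fun z => g.apply_symm_apply z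
  rw [Equiv.Perm.inv_eq_iff_eq, h2 (g⁻¹ y) ((g⁻¹).map_adj_iff.mpr hxy), hgg, hgg]

theorem UFplus_InUF {d : ℕ} {T : SimpleGraph V} {F : Subgroup (Equiv.Perm (Fin d))}
    {ι : LegalColoring T d} {g : T ≃g T} (hg : g ∈ UFplus T F ι) : InUF T F ι g := by
  induction hg using Subgroup.closure_induction with
  | mem x hx => exact hx.1
  | one => exact fun x => ⟨1, F.one_mem, fun y _ => rfl⟩
  | mul x y _ _ hx hy => exact hx.mul hy
  | inv x _ hx => exact hx.inv

/-! ### Proof: topology -/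

theorem ultra_const {α : Type} (𝒰 : Ultrafilter α) (f : α → V) (S : Set V) (hS : S.Finite)
    (h : ∀ᶠ x in (𝒰 : Filter α), f x ∈ S) : ∃ v, ∀ᶠ x in (𝒰 : Filter α), f x = v := by
  have : ∀ᶠ x in (𝒰 : Filter α), ∃ v ∈ S, f x = v := by
    filter_upwards [h] with x hx
    exact ⟨f x, hx, rfl⟩
  obtain ⟨v, _, hv⟩ := (Ultrafilter.eventually_exists_mem_iff hS).1 this
  exact ⟨v, hv⟩

theorem tendsto_aut (T : SimpleGraph V) (G : Subgroup (T ≃g T)) {α : Type} (l : Filter α)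
    (f : α → G) (g : G) (h : ∀ z, ∀ᶠ x in l, (f x : T ≃g T) z = (g : T ≃g T) z) :
    Tendsto f l (𝓝 g) := by
  rw [tendsto_subtype_rng]
  let _ : TopologicalSpace V := ⊥
  have hind : IsInducing (fun (g : T ≃g T) (x : V) => g x) := ⟨rfl⟩
  rw [hind.tendsto_nhds_iff, tendsto_pi_nhds]
  intro z
  exact tendsto_nhds_of_eventually_eq (h z)

theorem orbit_finite (T : SimpleGraph V) (G : Subgroup (T ≃g T)) (K : Set G) (hK : IsCompact K)
    (x : V) : ((fun g : G => (g : T ≃g T) x) '' K).Finite := by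
  let _ : TopologicalSpace V := ⊥
  have : DiscreteTopology V := ⟨rfl⟩
  have hind : IsInducing (fun (g : T ≃g T) (x : V) => g x) := ⟨rfl⟩
  have hc : Continuous (fun g : G => (g : T ≃g T) x) :=
    (continuous_apply x).comp (hind.continuous.comp continuous_subtype_val)
  exact (hK.image hc).finite_of_discrete

theorem coset_compact {d : ℕ} (T : SimpleGraph V) (hT : T.IsTree) (hf : LocFin T)
    (ι : LegalColoring T d) (F : Subgroup (Equiv.Perm (Fin d))) (x₀ x₁ : V)
    (hx : T.Adj x₀ x₁) (y : V) :
    IsCompact {g : UFplus T F ι | (g : T ≃g T) x₀ = y} := by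
  rw [isCompact_iff_ultrafilter_le_nhds']
  intro 𝒰 h𝒰
  have h0 : ∀ᶠ g : UFplus T F ι in (𝒰 : Filter (UFplus T F ι)), (g : T ≃g T) x₀ = y := h𝒰
  have hφ : ∀ z, ∃ v, ∀ᶠ g : UFplus T F ι in (𝒰 : Filter (UFplus T F ι)), (g : T ≃g T) z = v := by
    intro z
    apply ultra_const 𝒰 _ _ (ball_finite T hT hf y (T.dist x₀ z))
    filter_upwards [h0] with g hg
    have := iso_dist_eq T (g : T ≃g T) x₀ z
    rw [hg] at this
    exact this.le
  have hψ : ∀ z, ∃ v, ∀ᶠ g : UFplus T F ι in (𝒰 : Filter (UFplus T F ι)), (g : T ≃g T).symm z = v := by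
    intro z
    apply ultra_const 𝒰 _ _ (ball_finite T hT hf x₀ (T.dist y z))
    filter_upwards [h0] with g hg
    have := iso_dist_eq T (g : T ≃g T) x₀ ((g : T ≃g T).symm z)
    rw [hg] at this
    simp only [RelIso.apply_symm_apply] at this
    exact this.ge
  choose φ hφ using hφ
  choose ψ hψ using hψ
  have h1 : ∀ z, ψ (φ z) = z := by
    intro z
    obtain ⟨g, hg1, hg2⟩ := ((hφ z).and (hψ (φ z))).exists
    rw [← hg2, ← hg1]; simp
  have h2 : ∀ z, φ (ψ z) = z := by
    intro z
    obtain ⟨g, hg1, hg2⟩ := ((hψ z).and (hφ (ψ z))).exists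
    rw [← hg2, ← hg1]; simp
  let Φ : T ≃g T := ⟨⟨φ, ψ, h1, h2⟩, by
    intro u v
    obtain ⟨g, hg1, hg2⟩ := ((hφ u).and (hφ v)).exists
    change T.Adj (φ u) (φ v) ↔ _
    rw [← hg1, ← hg2]
    exact (g : T ≃g T).map_adj_iff⟩
  have hΦ : ∀ z, Φ z = φ z := fun _ => rfl
  have hUF : InUF T F ι Φ := by
    intro x
    have hall : ∀ᶠ g : UFplus T F ι in (𝒰 : Filter (UFplus T F ι)), ∀ z ∈ T.neighborSet x,
        (g : T ≃g T) z = φ z := (Filter.eventually_all_finite (hf x)).mpr (fun z _ => hφ z)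
    obtain ⟨g, hg1, hg2⟩ := ((hφ x).and hall).exists
    obtain ⟨σ, hσ, h⟩ := UFplus_InUF g.2 x
    refine ⟨σ, hσ, fun z hz => ?_⟩
    rw [h z hz, hΦ, hΦ, hg1, hg2 z hz]
  have hmem : Φ ∈ UFplus T F ι := by
    obtain ⟨g, hg1, hg2⟩ := ((hφ x₀).and (hφ x₁)).exists
    have h3 : (g : T ≃g T)⁻¹ * Φ ∈ UFplus T F ι := by
      apply Subgroup.subset_closure
      refine ⟨(UFplus_InUF g.2).inv.mul hUF, x₀, x₁, hx, ?_, ?_⟩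
      · change (g : T ≃g T).symm (φ x₀) = x₀
        rw [← hg1]; simp
      · change (g : T ≃g T).symm (φ x₁) = x₁
        rw [← hg2]; simp
    have := (UFplus T F ι).mul_mem g.2 h3
    simpa using this
  refine ⟨⟨Φ, hmem⟩, ?_, ?_⟩
  · obtain ⟨g, hg1, hg2⟩ := ((hφ x₀).and h0).exists
    change φ x₀ = y
    rw [← hg1, hg2]
  · exact tendsto_aut T _ (𝒰 : Filter (UFplus T F ι)) id ⟨Φ, hmem⟩ (fun z => hφ z)

/-! ### Proof: weak limits and the Mautner phenomenon -/

theorem weak_limit {G : Type} [Group G] [TopologicalSpace G]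
    {H : Type} [NormedAddCommGroup H] [InnerProductSpace ℂ H] [CompleteSpace H]
    (π : UnitaryRep G H) (𝒰 : Ultrafilter G) (v : H) :
    ∃ u : H, ∀ w : H, Tendsto (fun g : G => ⟪π.ρ g v, w⟫_ℂ) 𝒰 (𝓝 ⟪u, w⟫_ℂ) := by
  have hK := WeakDual.isCompact_closedBall (𝕜 := ℂ) (E := H) 0 ‖v‖
  let f : G → WeakDual ℂ H := fun g =>
    StrongDual.toWeakDual (InnerProductSpace.toDual ℂ H (π.ρ g v))
  have hmem : ∀ g, f g ∈ WeakDual.toStrongDual ⁻¹' Metric.closedBall (0 : StrongDual ℂ H) ‖v‖ := by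
    intro g
    simp [f]
  have hle : (𝒰.map f : Filter (WeakDual ℂ H)) ≤
      𝓟 (WeakDual.toStrongDual ⁻¹' Metric.closedBall (0 : StrongDual ℂ H) ‖v‖) := by
    rw [le_principal_iff]
    exact Ultrafilter.mem_map.mpr (Filter.Eventually.of_forall hmem)
  obtain ⟨φ, _, hφ⟩ := hK.ultrafilter_le_nhds (𝒰.map f) hle
  refine ⟨(InnerProductSpace.toDual ℂ H).symm (WeakDual.toStrongDual φ), fun w => ?_⟩
  have hφ' : Tendsto f 𝒰 (𝓝 φ) := hφ
  have h1 := ((WeakDual.eval_continuous (𝕜 := ℂ) w).tendsto φ).comp hφ'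
  rw [InnerProductSpace.toDual_symm_apply]
  exact h1

theorem mautner {G : Type} [Group G] [TopologicalSpace G]
    {H : Type} [NormedAddCommGroup H] [InnerProductSpace ℂ H]
    (π : UnitaryRep G H) (l : Filter G) [l.NeBot] (v u : H)
    (hu : ∀ w : H, Tendsto (fun g : G => ⟪π.ρ g v, w⟫_ℂ) l (𝓝 ⟪u, w⟫_ℂ))
    (h : G) (hh : Tendsto (fun g : G => g⁻¹ * h * g) l (𝓝 1)) : π.ρ h u = u := by
  have hm : ∀ (a b : G) (x : H), π.ρ (a * b) x = π.ρ a (π.ρ b x) := by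
    intro a b x
    rw [map_mul]; rfl
  have h1' : ∀ x : H, π.ρ 1 x = x := by
    intro x
    rw [map_one]; rfl
  refine ext_inner_right ℂ fun w => ?_
  have e1 : ⟪π.ρ h u, w⟫_ℂ = ⟪u, π.ρ h⁻¹ w⟫_ℂ := by
    rw [← (π.ρ h⁻¹).inner_map_map (π.ρ h u) w, ← hm, inv_mul_cancel, h1']
  have h1 := hu (π.ρ h⁻¹ w)
  rw [← e1] at h1
  have h2 : Tendsto (fun g : G => ‖π.ρ (g⁻¹ * h * g) v - v‖ * ‖w‖) l (𝓝 0) := by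
    have h3 : Tendsto (fun g : G => π.ρ (g⁻¹ * h * g) v) l (𝓝 v) := by
      have := ((π.strong_continuity v).tendsto 1).comp hh
      rw [h1'] at this
      exact this
    have h4 := (h3.sub_const v).norm.mul_const ‖w‖
    rw [sub_self, norm_zero, zero_mul] at h4
    exact h4
  have h3 : Tendsto (fun g : G => ⟪π.ρ g v, π.ρ h⁻¹ w⟫_ℂ - ⟪π.ρ g v, w⟫_ℂ) l (𝓝 0) := by
    refine squeeze_zero_norm (fun g => ?_) h2
    have e2 : ⟪π.ρ g v, π.ρ h⁻¹ w⟫_ℂ = ⟪π.ρ g (π.ρ (g⁻¹ * h * g) v), w⟫_ℂ := by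
      rw [← (π.ρ h).inner_map_map, ← hm, ← hm, ← hm, mul_inv_cancel, h1', mul_assoc,
        mul_inv_cancel_left]
    rw [e2, ← inner_sub_left, ← map_sub]
    refine (norm_inner_le_norm _ _).trans ?_
    rw [LinearIsometryEquiv.norm_map]
  have h4 := h1.sub (hu w)
  have h5 := tendsto_nhds_unique h4 h3
  exact sub_eq_zero.mp h5

/-! ### Proof: unboundedness of the isotropy group -/

theorem isotropy_not_compact {d : ℕ} (T : SimpleGraph V) (hd : 3 ≤ d)
    (hT : T.IsTree) (hreg : Regular T d) (ι : LegalColoring T d)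
    (F : Subgroup (Equiv.Perm (Fin d)))
    (hprim : PermPrimitive F) (hncyc : ¬ CyclicOfPrimeOrder F)
    {H : Type} [NormedAddCommGroup H] [InnerProductSpace ℂ H]
    (π : UnitaryRep (UFplus T F ι) H) (𝒰 : Ultrafilter (UFplus T F ι))
    (h𝒰 : (𝒰 : Filter (UFplus T F ι)) ≤ cocompact (UFplus T F ι)) (v u : H)
    (hu : ∀ w : H, Tendsto (fun g => ⟪π.ρ g v, w⟫_ℂ) 𝒰 (𝓝 ⟪u, w⟫_ℂ)) :
    ¬ IsCompact {g : UFplus T F ι | π.ρ g u = u} := by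
  intro hK
  have hf : LocFin T := by
    intro x
    apply Set.finite_of_ncard_ne_zero
    rw [hreg x]; omega
  obtain ⟨x₀⟩ := hT.connected.nonempty
  obtain ⟨x₁, hx₁⟩ : ∃ x₁, T.Adj x₀ x₁ := by
    obtain ⟨y, hy, _⟩ := ι.surjOn x₀ (Set.mem_univ ⟨0, by omega⟩)
    exact ⟨y, hy⟩
  -- the orbit escapes
  have hesc : ∀ (y : V) (n : ℕ), ∀ᶠ g : UFplus T F ι in (𝒰 : Filter (UFplus T F ι)),
      n < T.dist y ((g : T ≃g T) x₀) := by
    intro y n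
    have hc : IsCompact (⋃ z ∈ {z | T.dist y z ≤ n},
        {g : UFplus T F ι | (g : T ≃g T) x₀ = z}) :=
      (ball_finite T hT hf y n).isCompact_biUnion
        (fun z _ => coset_compact T hT hf ι F x₀ x₁ hx₁ z)
    have := h𝒰 hc.compl_mem_cocompact
    filter_upwards [this] with g hg
    by_contra hcon
    apply hg
    simp only [Set.mem_iUnion]
    exact ⟨(g : T ≃g T) x₀, not_lt.mp hcon, rfl⟩
  -- the direction towards the limit end
  have hnext : ∀ y : V, ∃ z, T.Adj y z ∧
      ∀ᶠ g : UFplus T F ι in (𝒰 : Filter (UFplus T F ι)),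
        T.dist y ((g : T ≃g T) x₀) = T.dist z ((g : T ≃g T) x₀) + 1 := by
    intro y
    have : ∀ᶠ g : UFplus T F ι in (𝒰 : Filter (UFplus T F ι)), ∃ z ∈ T.neighborSet y,
        T.dist y ((g : T ≃g T) x₀) = T.dist z ((g : T ≃g T) x₀) + 1 := by
      filter_upwards [hesc y 0] with g hg
      have hne : y ≠ (g : T ≃g T) x₀ := by
        rintro h
        rw [← h] at hg
        simp at hg
      obtain ⟨z, hz, hz'⟩ := exists_closer T hT ((g : T ≃g T) x₀) y hne
      refine ⟨z, hz, ?_⟩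
      rw [SimpleGraph.dist_comm, hz', SimpleGraph.dist_comm]
    obtain ⟨z, hz, hz'⟩ := (Ultrafilter.eventually_exists_mem_iff (hf y)).1 this
    exact ⟨z, hz, hz'⟩
  choose nx hnx1 hnx2 using hnext
  -- elements fixing a half-tree around the end fix `u`
  have hinv : ∀ (y : V) (h : UFplus T F ι),
      (∀ z ∈ EdgeSide T (nx y) y, (h : T ≃g T) z = z) → π.ρ h u = u := by
    intro y h hh
    refine mautner π 𝒰 v u hu h ?_
    refine tendsto_aut T _ _ _ 1 fun z => ?_
    filter_upwards [hesc y (T.dist z x₀), hnx2 y] with g hg1 hg2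
    have hside : (g : T ≃g T) z ∈ EdgeSide T (nx y) y := by
      by_contra hcon
      have h1 := (side_or T hT (hnx1 y).symm ((g : T ≃g T) z)).resolve_left hcon
      have h2 : (g : T ≃g T) x₀ ∈ EdgeSide T (nx y) y := hg2
      have h3 := dist_cross T hT (hnx1 y) h1 h2
      rw [iso_dist_eq] at h3
      omega
    have h4 := hh _ hside
    change (g : T ≃g T).symm ((h : T ≃g T) ((g : T ≃g T) z)) = z
    rw [h4]; simp
  -- the ray
  let r : ℕ → V := fun n => nx^[n] x₀
  have hr : ∀ n, r (n + 1) = nx (r n) := fun n => Function.iterate_succ_apply' nx n x₀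
  have hrd : ∀ n, ∀ᶠ g : UFplus T F ι in (𝒰 : Filter (UFplus T F ι)),
      T.dist x₀ ((g : T ≃g T) x₀) = T.dist (r n) ((g : T ≃g T) x₀) + n := by
    intro n
    induction n with
    | zero => exact Filter.Eventually.of_forall fun g => rfl
    | succ n ih =>
      filter_upwards [ih, hnx2 (r n)] with g hg1 hg2
      rw [hr]
      omega
  have hrle : ∀ n, T.dist x₀ (r n) ≤ n := by
    intro n
    induction n with
    | zero => simp [r]
    | succ n ih =>
      have h1 : T.dist x₀ (r (n + 1)) ≤ T.dist x₀ (r n) + T.dist (r n) (r (n + 1)) :=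
        hT.connected.dist_triangle
      have h2 : T.dist (r n) (r (n + 1)) = 1 := by
        rw [hr]; exact SimpleGraph.dist_eq_one_iff_adj.mpr (hnx1 _)
      omega
  have hrn : ∀ n, T.dist x₀ (r n) = n := by
    intro n
    obtain ⟨g, hg⟩ := (hrd n).exists
    have h1 : T.dist x₀ ((g : T ≃g T) x₀) ≤ T.dist x₀ (r n) + T.dist (r n) ((g : T ≃g T) x₀) :=
      hT.connected.dist_triangle
    have := hrle n
    omega
  -- conclusion
  have hfin := orbit_finite T _ _ hK x₀
  obtain ⟨N, hN⟩ := (hfin.image (fun y => T.dist x₀ y)).bddAbove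
  have hbig : ∀ n : ℕ, ∃ h : UFplus T F ι, π.ρ h u = u ∧ n ≤ T.dist x₀ ((h : T ≃g T) x₀) := by
    intro n
    have hpq : T.Adj (r n) (r (n + 1)) := by rw [hr]; exact hnx1 _
    have hqs : T.Adj (r (n + 1)) (r (n + 2)) := by rw [hr (n + 1)]; exact hnx1 _
    have hps : r (n + 2) ≠ r n := by
      intro h
      have h1 := hrn (n + 2)
      rw [h, hrn n] at h1
      omega
    have hcol : ι.color (r (n + 1)) (r (n + 2)) ≠ ι.color (r (n + 1)) (r n) := by
      intro h
      exact hps (ι.injOn _ hqs hpq.symm h)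
    obtain ⟨σ, hσ, hσ1, hσ2⟩ := stab_moves hd F hprim hncyc _ _ hcol
    obtain ⟨h, hUF, hfix, hside, hact⟩ := exists_halfIso T hT ι F σ hσ _ _ hqs hσ1
    have hmem : h ∈ UFplus T F ι := Subgroup.subset_closure
      ⟨hUF, _, _, hqs, hfix, hside _ (side_self T hqs.symm)⟩
    refine ⟨⟨h, hmem⟩, hinv (r (n + 1)) ⟨h, hmem⟩ ?_, ?_⟩
    · intro z hz
      rw [← hr] at hz
      exact hside z hz
    · change n ≤ T.dist x₀ (h x₀)
      have hmove : h (r n) ≠ r n := by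
        intro he
        have := hact (r n) hpq.symm
        rw [he] at this
        exact hσ2 this.symm
      have hadj : T.Adj (r (n + 1)) (h (r n)) := by
        have := h.map_adj_iff.mpr hpq.symm
        rwa [hfix] at this
      have hx0 : x₀ ∈ EdgeSide T (r n) (r (n + 1)) := by
        simp only [EdgeSide, Set.mem_ofPred_eq]
        rw [SimpleGraph.dist_comm, hrn, SimpleGraph.dist_comm, hrn]
      have hhx0 : h x₀ ∈ EdgeSide T (r (n + 1)) (r n) := by
        by_contra hcon
        have h1 := (side_or T hT hpq (h x₀)).resolve_right hcon
        simp only [EdgeSide, Set.mem_ofPred_eq] at h1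
        apply hmove
        have h2 := iso_dist_eq T h x₀ (r n)
        have h3 := iso_dist_eq T h x₀ (r (n + 1))
        rw [hfix, hrn] at h3
        rw [hrn] at h2
        refine closer_unique T hT (h x₀) (r (n + 1)) _ _ hadj hpq.symm (by omega) ?_
        rw [SimpleGraph.dist_comm, h1, SimpleGraph.dist_comm]
      have h1 := dist_cross T hT hpq hx0 hhx0
      rw [hrn] at h1
      omega
  obtain ⟨h, hh1, hh2⟩ := hbig (N + 1)
  have := hN ⟨(h : T ≃g T) x₀, ⟨h, hh1, rfl⟩, rfl⟩
  simp only at this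
  omega

/-- Let `d ≥ 3` and let `F ≤ Sym({1,…,d})` be primitive but not cyclic of
prime order.  Then `U(F)⁺` has the Howe–Moore property if and only if for every unitary
representation of `U(F)⁺` without nonzero invariant vectors and every nonzero vector `v`,
the isotropy subgroup of `v` is compact. -/
theorem howeMoore_iff_isotropy_compact
    {V : Type} (T : SimpleGraph V) (d : ℕ) (hd : 3 ≤ d)
    (hT : T.IsTree) (hreg : Regular T d) (ι : LegalColoring T d)
    (F : Subgroup (Equiv.Perm (Fin d)))
    (hprim : PermPrimitive F) (hncyc : ¬ CyclicOfPrimeOrder F) :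
    HasHoweMoore (UFplus T F ι) ↔
      ∀ (H : Type) [NormedAddCommGroup H] [InnerProductSpace ℂ H] [CompleteSpace H]
        (π : UnitaryRep (UFplus T F ι) H),
        NoInvariantVectors π →
          ∀ v : H, v ≠ 0 →
            IsCompact {g : UFplus T F ι | π.ρ g v = v} := by
  constructor
  · intro hHM H _ _ _ π hπ v hv
    have h1 := hHM H π hπ v v
    have hclosed : IsClosed {g : UFplus T F ι | π.ρ g v = v} :=
      isClosed_eq (π.strong_continuity v) continuous_const
    have hne : ⟪v, v⟫_ℂ ≠ 0 := inner_self_ne_zero.mpr hv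
    have h2 : ∀ᶠ g in cocompact (UFplus T F ι), ⟪π.ρ g v, v⟫_ℂ ≠ ⟪v, v⟫_ℂ :=
      h1.eventually_ne hne.symm
    obtain ⟨K, hK, hsub⟩ := mem_cocompact.mp h2
    refine hK.of_isClosed_subset hclosed ?_
    intro g hg
    by_contra hgK
    have hg' : π.ρ g v = v := hg
    exact hsub hgK (by rw [hg'])
  · intro hiso H _ _ _ π hπ v w
    rw [tendsto_iff_ultrafilter]
    intro 𝒰 h𝒰
    obtain ⟨u, hu⟩ := weak_limit π 𝒰 v
    have hu0 : u = 0 := by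
      by_contra hne
      exact isotropy_not_compact T hd hT hreg ι F hprim hncyc π 𝒰 h𝒰 v u hu
        (hiso H π hπ u hne)
    have := hu w
    rwa [hu0, inner_zero_left] at this

end TreeHM
end

section
/- Let T be a locally finite tree, let G ≤ Aut(T) be a closed, non-compact subgroup with Tits' independence property, and let (π, ℋ) be a unitary representation of G. Assume there exist a sequence (g_n) in G and a vector v ∈ ℋ such that g_n → ∞ and π(g_n)v converges weakly to a nonzero vector v₀ ∈ ℋ. Then for every end ξ ∈ ∂T with the property that there exist a vertex x ∈ T and a subsequence (g_{n_k}) with g_{n_k}(x) → ξ, one has N⁺_{(g_{n_k})} ⊆ G_ξ⁰ ⊆ G_{v₀}, where G_{v₀} = {g ∈ G : π(g)v₀ = v₀}. -/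
open Filter Topology
open scoped InnerProductSpace

namespace TreeHM

variable {V : Type}

theorem tree_side (T : SimpleGraph V) (hT : T.IsTree) {a b : V} (hab : T.Adj a b) (y : V) :
    T.dist a y = T.dist b y + 1 ∨ T.dist b y = T.dist a y + 1 := by
  have := hT.dist_eq_dist_add_one_of_adj y hab
  rwa [T.dist_comm (u := y) (v := a), T.dist_comm (u := y) (v := b)] at this

theorem mem_geod (T : SimpleGraph V) {u v w : V} (p : T.Walk u v)
    (hp : p.length = T.dist u v) (hw : w ∈ p.support) :
    T.dist u w + T.dist w v ≤ T.dist u v := by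
  classical
  have h1 := SimpleGraph.dist_le (p.takeUntil w hw)
  have h2 := SimpleGraph.dist_le (p.dropUntil w hw)
  have h3 := congrArg SimpleGraph.Walk.length (p.take_spec hw)
  rw [SimpleGraph.Walk.length_append] at h3
  omega

theorem tree_concat (T : SimpleGraph V) (hT : T.IsTree) {a b y z : V} (hab : T.Adj a b)
    (hy : T.dist b y = T.dist a y + 1) (hz : T.dist a z = T.dist b z + 1) :
    T.dist y z = T.dist a y + 1 + T.dist b z := by
  obtain ⟨p, hp, hpl⟩ := hT.connected.exists_path_of_dist y a
  obtain ⟨q, hq, hql⟩ := hT.connected.exists_path_of_dist b z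
  have hdisj : ∀ w, w ∈ p.support → w ∉ q.support := by
    intro w h1 h2
    have e1 := mem_geod T p hpl h1
    have e2 := mem_geod T q hql h2
    have t1 := hT.connected.dist_triangle (u := b) (v := w) (w := y)
    have t2 := hT.connected.dist_triangle (u := a) (v := w) (w := z)
    have c1 := T.dist_comm (u := w) (v := y)
    have c2 := T.dist_comm (u := w) (v := a)
    have c3 := T.dist_comm (u := y) (v := a)
    omega
  have hpath : (p.append (SimpleGraph.Walk.cons hab q)).IsPath := by
    rw [SimpleGraph.Walk.isPath_def, SimpleGraph.Walk.support_append]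
    simp only [SimpleGraph.Walk.support_cons, List.tail_cons]
    rw [List.nodup_append']
    exact ⟨hp.support_nodup, hq.support_nodup, fun w h1 h2 => hdisj w h1 h2⟩
  obtain ⟨r, hr, hrl⟩ := hT.connected.exists_path_of_dist y z
  have := congrArg Subtype.val (hT.isAcyclic.path_unique ⟨_, hpath⟩ ⟨r, hr⟩)
  have h := congrArg SimpleGraph.Walk.length this
  simp only [SimpleGraph.Walk.length_append, SimpleGraph.Walk.length_cons] at h
  have c3 := T.dist_comm (u := y) (v := a)
  omega

theorem tree_between_unique (T : SimpleGraph V) (hT : T.IsTree) {y z p q : V}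
    (h1 : T.dist y p = T.dist y q) (h2 : T.dist p z = T.dist q z)
    (h3 : T.dist y p + T.dist p z = T.dist y z) : p = q := by
  obtain ⟨a1, ha1⟩ := hT.connected.exists_walk_length_eq_dist y p
  obtain ⟨a2, ha2⟩ := hT.connected.exists_walk_length_eq_dist p z
  obtain ⟨b1, hb1⟩ := hT.connected.exists_walk_length_eq_dist y q
  obtain ⟨b2, hb2⟩ := hT.connected.exists_walk_length_eq_dist q z
  have ha : (a1.append a2).IsPath := SimpleGraph.Walk.isPath_of_length_eq_dist _ (by
    rw [SimpleGraph.Walk.length_append]; omega)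
  have hb : (b1.append b2).IsPath := SimpleGraph.Walk.isPath_of_length_eq_dist _ (by
    rw [SimpleGraph.Walk.length_append]; omega)
  have := congrArg Subtype.val (hT.isAcyclic.path_unique ⟨_, ha⟩ ⟨_, hb⟩)
  have h := congrArg (fun w => SimpleGraph.Walk.getVert w (T.dist y p)) this
  simp only [SimpleGraph.Walk.getVert_append] at h
  rw [ha1, hb1, h1] at h
  simpa using h

theorem ray_dist (T : SimpleGraph V) (r : GeodRay T) (m n : ℕ) :
    T.dist (r.seq m) (r.seq (m + n)) = n := by
  rw [r.geodesic, Nat.dist_eq_sub_of_le (Nat.le_add_right m n)]; omega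

theorem ray_dist0 (T : SimpleGraph V) (r : GeodRay T) (n : ℕ) :
    T.dist (r.seq 0) (r.seq n) = n := by
  simpa using ray_dist T r 0 n

/-- Points close to the base point lie on the near side. -/
theorem near_side (T : SimpleGraph V) (hT : T.IsTree) (r : GeodRay T) {m : ℕ} {y : V}
    (hm : T.dist (r.seq 0) y ≤ m) :
    T.dist (r.seq (m + 1)) y = T.dist (r.seq m) y + 1 := by
  rcases tree_side T hT (r.adj m) y with h | h
  · have h0 := ray_dist0 T r m
    have h1 := ray_dist0 T r (m + 1)
    have c0 := T.dist_comm (u := r.seq 0) (v := r.seq m)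
    have c1 := T.dist_comm (u := r.seq 0) (v := r.seq (m + 1))
    have := tree_concat T hT (r.adj m) (y := r.seq 0) (z := y) (by omega) h
    omega
  · exact h

/-- Points beyond `r.seq (m+1+R)` are at distance more than `R` beyond the edge. -/
theorem far_side (T : SimpleGraph V) (hT : T.IsTree) (r : GeodRay T) {m R : ℕ} {y : V}
    (hy : T.dist (r.seq 0) y = (m + 1 + R) + T.dist (r.seq (m + 1 + R)) y) :
    T.dist (r.seq m) y = T.dist (r.seq (m + 1)) y + 1 ∧ R ≤ T.dist (r.seq (m + 1)) y := by
  have h0 := ray_dist0 T r m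
  have h1 := ray_dist0 T r (m + 1)
  have h2 := ray_dist T r (m + 1) R
  have t0 := hT.connected.dist_triangle (u := r.seq 0) (v := r.seq m) (w := y)
  have t1 := hT.connected.dist_triangle (u := r.seq 0) (v := r.seq (m + 1)) (w := y)
  have t2 := hT.connected.dist_triangle (u := r.seq (m + 1)) (v := r.seq (m + 1 + R)) (w := y)
  rcases tree_side T hT (r.adj m) y with h | h
  · exact ⟨h, by omega⟩
  · omega

/-- If `u` fixes a sequence of vertices converging to the end, it fixes a subray. -/
theorem fix_tail_of_fix (T : SimpleGraph V) (hT : T.IsTree) (r : GeodRay T) (u : T ≃g T)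
    (y : ℕ → V) (hy : TendstoEnd T y r) (hu : ∀ᶠ n in atTop, u (y n) = y n) :
    ∃ M, ∀ m, M ≤ m → u (r.seq m) = r.seq m := by
  obtain ⟨K, hK⟩ := eventually_atTop.1 hu
  refine ⟨T.dist (r.seq 0) (y K), fun m hm => ?_⟩
  obtain ⟨k, hk1, hk2⟩ := ((hy (m + 1 + 0)).and (eventually_ge_atTop K)).exists
  have hf := (far_side T hT r hk1).1
  have hn := near_side T hT r hm
  have hc := tree_concat T hT (r.adj m) hn hf
  have fK := hK K le_rfl
  have fk := hK k hk2
  have d1 := iso_dist_eq T u (y K) (r.seq m)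
  have d2 := iso_dist_eq T u (r.seq m) (y k)
  rw [fK] at d1
  rw [fk] at d2
  have c := T.dist_comm (u := r.seq m) (v := y K)
  exact (tree_between_unique T hT d1.symm d2.symm (by omega)).symm

theorem fix_tail_bound (T : SimpleGraph V) (hT : T.IsTree) (r : GeodRay T) (u : T ≃g T)
    (hu : ∃ M, ∀ m, M ≤ m → u (r.seq m) = r.seq m) (m : ℕ)
    (hm : T.dist (r.seq 0) (u (r.seq 0)) ≤ m) : u (r.seq m) = r.seq m := by
  obtain ⟨M, hM⟩ := hu
  have hn0 := near_side T hT r (m := m) (y := u (r.seq 0)) hm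
  have hn := T.dist_comm (u := r.seq m) (v := u (r.seq 0))
  have hfar : T.dist (r.seq m) (r.seq (m + 1 + M)) = T.dist (r.seq (m + 1)) (r.seq (m + 1 + M)) + 1 := by
    rw [ray_dist, show m + 1 + M = m + (1 + M) by omega, ray_dist]; omega
  have hc := tree_concat T hT (r.adj m) hn0 hfar
  have e1 := ray_dist T r (m + 1) M
  have e2 := ray_dist0 T r (m + 1 + M)
  have hfix := hM (m + 1 + M) (by omega)
  have d0 := iso_dist_eq T u (r.seq 0) (r.seq (m + 1 + M))
  have d1 := iso_dist_eq T u (r.seq 0) (r.seq m)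
  have d2 := iso_dist_eq T u (r.seq m) (r.seq (m + 1 + M))
  rw [hfix] at d0 d2
  have e3 := ray_dist0 T r m
  exact (tree_between_unique T hT (y := u (r.seq 0)) (z := r.seq (m + 1 + M))
    (p := r.seq m) (q := u (r.seq m)) (by omega) (by omega) (by omega)).symm

theorem fix_tail_of_endStab (T : SimpleGraph V) (hT : T.IsTree) (r : GeodRay T) (u : T ≃g T)
    (hu : FixesEnd T u r) (hx : ∃ x, u x = x) :
    ∃ M, ∀ m, M ≤ m → u (r.seq m) = r.seq m := by
  obtain ⟨k, l, hkl⟩ := hu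
  obtain ⟨y, hy⟩ := hx
  have hkl' : ∀ n, u (r.seq (k + n)) = r.seq (l + n) := hkl
  have key : ∀ n, T.dist y (r.seq (l + n)) = T.dist y (r.seq (k + n)) := by
    intro n
    rw [← hkl', ← iso_dist_eq T u y (r.seq (k + n)), hy]
  -- beyond the projection of `y`, distance grows with slope one
  have grow : ∀ m, T.dist (r.seq 0) y ≤ m →
      T.dist y (r.seq m) = T.dist y (r.seq (T.dist (r.seq 0) y)) + (m - T.dist (r.seq 0) y) := by
    intro m hm
    induction m, hm using Nat.le_induction with
    | base => simp
    | succ m hm ih =>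
      have := near_side T hT r hm
      rw [T.dist_comm (v := y), T.dist_comm (v := y)] at this
      omega
  have := key (T.dist (r.seq 0) y)
  rw [grow _ (by omega), grow (k + _) (by omega)] at this
  have hlk : l = k := by omega
  subst hlk
  refine ⟨l, fun m hm => ?_⟩
  obtain ⟨n, rfl⟩ := Nat.exists_eq_add_of_le hm
  exact hkl' n

theorem tendsto_iff_eventually (T : SimpleGraph V) (G : Subgroup (T ≃g T)) {ι : Type}
    (l : Filter ι) (f : ι → G) (h : G) :
    Tendsto f l (𝓝 h) ↔ ∀ z : V, ∀ᶠ i in l, (f i : T ≃g T) z = (h : T ≃g T) z := by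
  letI : TopologicalSpace V := ⊥
  haveI : DiscreteTopology V := ⟨rfl⟩
  have hind : Topology.IsInducing (fun (g : T ≃g T) (x : V) => g x) := ⟨rfl⟩
  rw [tendsto_subtype_rng, hind.tendsto_nhds_iff, tendsto_pi_nhds]
  refine forall_congr' fun z => ?_
  rw [nhds_discrete, tendsto_pure]
  rfl

theorem eventually_nhds_eq (T : SimpleGraph V) (G : Subgroup (T ≃g T)) (h : G) (z : V) :
    ∀ᶠ u : G in 𝓝 h, (u : T ≃g T) z = (h : T ≃g T) z :=
  (tendsto_iff_eventually T G (𝓝 h) id h).1 tendsto_id z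

/-- Mautner phenomenon. -/
theorem mautner_contr {G : Type} [Group G] [TopologicalSpace G]
    {H : Type} [NormedAddCommGroup H] [InnerProductSpace ℂ H]
    (π : UnitaryRep G H) (α : ℕ → G) (v v₀ : H)
    (hweak : ∀ w : H, Tendsto (fun n : ℕ => ⟪π.ρ (α n) v, w⟫_ℂ) atTop (𝓝 ⟪v₀, w⟫_ℂ))
    (h : G) (hh : h ∈ ContrSeq α) : π.ρ h v₀ = v₀ := by
  have hn : Tendsto (fun n => ‖π.ρ h (π.ρ (α n) v) - π.ρ (α n) v‖) atTop (𝓝 0) := by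
    have h1 : Tendsto (fun n => π.ρ ((α n)⁻¹ * h * α n) v) atTop (𝓝 (π.ρ 1 v)) :=
      ((π.strong_continuity v).tendsto 1).comp hh
    rw [map_one] at h1
    have h2 := (h1.sub_const v).norm
    simp only [LinearIsometryEquiv.coe_one, id, sub_self, norm_zero] at h2
    refine h2.congr fun n => ?_
    rw [← LinearIsometryEquiv.norm_map (π.ρ (α n)), map_sub]
    congr 2
    have e : α n * ((α n)⁻¹ * h * α n) = h * α n := by group
    have e1 : π.ρ (α n) (π.ρ ((α n)⁻¹ * h * α n) v) = π.ρ (α n * ((α n)⁻¹ * h * α n)) v := by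
      rw [map_mul π.ρ (α n)]; rfl
    rw [e1, e, map_mul]; rfl
  refine ext_inner_right ℂ fun w => ?_
  have hmove : ∀ a : H, ⟪π.ρ h a, w⟫_ℂ = ⟪a, (π.ρ h).symm w⟫_ℂ := fun a => by
    conv_rhs => rw [← LinearIsometryEquiv.inner_map_map (π.ρ h)]
    rw [LinearIsometryEquiv.apply_symm_apply]
  have l1 : Tendsto (fun n => ⟪π.ρ h (π.ρ (α n) v), w⟫_ℂ) atTop (𝓝 ⟪π.ρ h v₀, w⟫_ℂ) := by
    simp only [hmove]
    exact hweak _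
  have l2 : Tendsto (fun n => ⟪π.ρ h (π.ρ (α n) v), w⟫_ℂ - ⟪π.ρ (α n) v, w⟫_ℂ) atTop (𝓝 0) := by
    refine squeeze_zero_norm (fun n => ?_) (by simpa using hn.mul_const ‖w‖)
    rw [← inner_sub_left]
    exact norm_inner_le_norm _ _
  have l3 := l1.sub (hweak w)
  exact sub_eq_zero.1 (tendsto_nhds_unique l3 l2)


/-- strengthening of Mautner's phenomenon.  Let `T` be a locally finite
tree, `G ≤ Aut(T)` a closed non-compact subgroup with Tits' independence property, and
`(π, ℋ)` a unitary representation of `G`.  If `g_n → ∞` in `G` and `π(g_n) v` converges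
weakly to some `v₀ ≠ 0`, then for every end `ξ` such that `g_{n_k}(x) → ξ` for some vertex
`x` and subsequence `(g_{n_k})`, one has `N⁺_{(g_{n_k})} ⊆ G_ξ⁰ ⊆ G_{v₀}`. -/
theorem strong_mautner
    {V : Type} (T : SimpleGraph V) (hT : T.IsTree) (hlf : LocFin T)
    (G : Subgroup (T ≃g T)) (hclosed : IsClosed (G : Set (T ≃g T)))
    (hnoncpt : ¬ IsCompact (G : Set (T ≃g T))) (htits : TitsIndep T G)
    (H : Type) [NormedAddCommGroup H] [InnerProductSpace ℂ H] [CompleteSpace H]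
    (π : UnitaryRep G H)
    (g : ℕ → G) (v : H)
    (hinf : Tendsto g atTop (cocompact G))
    (v₀ : H) (hv₀ : v₀ ≠ 0)
    (hweak : ∀ w : H, Tendsto (fun n : ℕ => ⟪π.ρ (g n) v, w⟫_ℂ) atTop (𝓝 ⟪v₀, w⟫_ℂ))
    (ξ : GeodRay T) (x : V) (φ : ℕ → ℕ) (hφ : StrictMono φ)
    (hconv : TendstoEnd T (fun k : ℕ => ((g (φ k) : T ≃g T)) x) ξ) :
    closure (ContrSeq (fun k : ℕ => g (φ k))) ⊆ EndStab0 T G ξ ∧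
      EndStab0 T G ξ ⊆ {h : G | π.ρ h v₀ = v₀} := by
  have hweak' : ∀ w : H, Tendsto (fun k : ℕ => ⟪π.ρ (g (φ k)) v, w⟫_ℂ) atTop (𝓝 ⟪v₀, w⟫_ℂ) :=
    fun w => (hweak w).comp hφ.tendsto_atTop
  constructor
  · intro h hh
    have hcontr : ∀ u ∈ ContrSeq (fun k : ℕ => g (φ k)),
        ∃ M, ∀ m, M ≤ m → (u : T ≃g T) (ξ.seq m) = ξ.seq m := by
      intro u hu
      refine fix_tail_of_fix T hT ξ u _ hconv ?_
      have := (tendsto_iff_eventually T G _ _ _).1 hu x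
      filter_upwards [this] with n hn
      have h2 := congrArg (fun z => ((g (φ n) : T ≃g T)) z) hn
      simpa using h2
    have hfix : ∀ m, T.dist (ξ.seq 0) ((h : T ≃g T) (ξ.seq 0)) ≤ m →
        (h : T ≃g T) (ξ.seq m) = ξ.seq m := by
      intro m hm
      obtain ⟨u, hu, hu0, hum⟩ := ((mem_closure_iff_frequently.1 hh).and_eventually
        ((eventually_nhds_eq T G h (ξ.seq 0)).and (eventually_nhds_eq T G h (ξ.seq m)))).exists
      rw [← hum]
      exact fix_tail_bound T hT ξ u (hcontr u hu) m (by rw [hu0]; exact hm)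
    refine ⟨⟨T.dist (ξ.seq 0) ((h : T ≃g T) (ξ.seq 0)),
      T.dist (ξ.seq 0) ((h : T ≃g T) (ξ.seq 0)), fun n => ?_⟩, ⟨_, hfix _ le_rfl⟩⟩
    exact hfix _ (Nat.le_add_right _ _)
  · rintro h ⟨hend, hx⟩
    obtain ⟨M, hM⟩ := fix_tail_of_endStab T hT ξ h hend hx
    have hdec : ∀ n : ℕ, ∃ k : G, k ∈ ContrSeq (fun k : ℕ => g (φ k)) ∧
        ∀ z, T.dist (ξ.seq 0) ((h : T ≃g T) z) ≤ M + n →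
          (k : T ≃g T) z = (h : T ≃g T) z := by
      intro n
      obtain ⟨g₁, hg₁, g₂, hg₂, hprod, hf1, hf2⟩ := htits (ξ.seq (M + n)) (ξ.seq (M + n + 1))
        (ξ.adj _) h h.2 (hM _ (by omega)) (hM _ (by omega))
      refine ⟨⟨g₂, hg₂⟩, ?_, ?_⟩
      · refine (tendsto_iff_eventually T G _ _ _).2 fun z => ?_
        filter_upwards [hconv (M + n + 1 + T.dist x z)] with k hk
        obtain ⟨hfar, hR⟩ := far_side T hT ξ hk
        have hz : (g (φ k) : T ≃g T) z ∈ EdgeSide T (ξ.seq (M + n + 1)) (ξ.seq (M + n)) := by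
          rcases tree_side T hT (ξ.adj (M + n)) ((g (φ k) : T ≃g T) z) with h | h
          · exact h
          · have hc := tree_concat T hT (ξ.adj (M + n)) h hfar
            rw [iso_dist_eq, T.dist_comm (u := z)] at hc
            omega
        have := hf2 _ hz
        simp [this]
      · intro z hz
        have hs := near_side T hT ξ hz
        have e := hf1 _ hs
        have e2 : (h : T ≃g T) z = g₁ (g₂ z) := by rw [hprod]; rfl
        have := g₁.injective (e.trans e2)
        exact this.symm
    choose k hk1 hk2 using hdec
    have hlim : Tendsto k atTop (𝓝 h) := by
      refine (tendsto_iff_eventually T G _ _ _).2 fun z => ?_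
      filter_upwards [eventually_ge_atTop (T.dist (ξ.seq 0) ((h : T ≃g T) z))] with n hn
      exact hk2 n z (by omega)
    have hc := ((π.strong_continuity v₀).tendsto h).comp hlim
    refine (tendsto_nhds_unique hc ?_ : π.ρ h v₀ = v₀)
    refine tendsto_const_nhds.congr fun n => ?_
    exact (mautner_contr π _ v v₀ hweak' (k n) (hk1 n)).symm

end TreeHM
end
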